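/- The normalized uniform measures on the spheres S^{n-1}_{c√n} in R^n converge weakly (as measures on R^∞, via the coordinate projections) to the product of countably many identical Gaussian measures on R with mean 0 and variance c^2; equivalently, for each fixed k, the joint distribution of the first k coordinates converges weakly to the standard k-dimensional Gaussian with covariance c^2·I. -/

import Mathlib

open MeasureTheory Filter ProbabilityTheory

namespace MaxwellPoincare

/-- The integral of an absolute value is bounded by the root of the second moment. -/
lemma integral_abs_sq_le {Ω : Type*} [MeasurableSpace Ω] (P : Measure Ω) [IsProbabilityMeasure P]
    (f : Ω → ℝ) (hf : MemLp f 2 P) : (∫ x, |f x| ∂P) ^ 2 ≤ ∫ x, f x ^ 2 ∂P := by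
  have h := variance_nonneg (fun x => |f x|) P
  rw [variance_eq_sub (by simpa using hf.norm)] at h
  simp only [Pi.pow_apply, sq_abs] at h
  linarith

lemma integral_sq_gaussian : ∫ x, x ^ 2 ∂(gaussianReal 0 1) = 1 := by
  have h := variance_fun_id_gaussianReal (μ := 0) (v := 1)
  rw [variance_eq_sub (X := fun x : ℝ => x) (IsGaussian.memLp_two_id (μ := gaussianReal 0 1))] at h
  simpa using h

lemma memLp_sq_gaussian : MemLp (fun x : ℝ => x ^ 2) 2 (gaussianReal 0 1) := by
  have h := memLp_id_gaussianReal' (μ := 0) (v := 1) 4 (by simp)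
  rw [memLp_two_iff_integrable_sq (by fun_prop)]
  have := h.integrable_norm_pow (p := 4) (by simp)
  refine this.congr (ae_of_all _ fun x => ?_)
  simp only [id, Real.norm_eq_abs, ← pow_mul]
  exact (Even.pow_abs (by decide) x)

lemma gaussian_norm (n : ℕ) (hn : 0 < n) :
    Integrable (fun z => |‖z‖ / √n - 1|) (stdGaussian (EuclideanSpace ℝ (Fin n))) ∧
    ∫ z, |‖z‖ / √n - 1| ∂(stdGaussian (EuclideanSpace ℝ (Fin n))) ≤
      √(Var[fun x : ℝ => x ^ 2; gaussianReal 0 1] / n) := by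
  set V := Var[fun x : ℝ => x ^ 2; gaussianReal 0 1] with hV
  have hn' : (0 : ℝ) < n := by exact_mod_cast hn
  let P := Measure.pi (fun _ : Fin n => gaussianReal 0 1)
  let S : (Fin n → ℝ) → ℝ := fun x => ∑ i, x i ^ 2
  have hmem : ∀ i : Fin n, MemLp (fun x : Fin n → ℝ => x i ^ 2) 2 P := fun i =>
    memLp_sq_gaussian.comp_measurePreserving (measurePreserving_eval _ i)
  have hS : MemLp S 2 P := memLp_finsetSum _ fun i _ => hmem i
  have hmean : ∫ x, S x ∂P = n := by
    rw [integral_finsetSum _ fun i _ => (hmem i).integrable (by simp)]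
    have : ∀ i : Fin n, ∫ x, x i ^ 2 ∂P = 1 := fun i => by
      rw [← integral_sq_gaussian, ← (measurePreserving_eval (fun _ : Fin n => gaussianReal 0 1) i).map_eq,
        integral_map (measurable_pi_apply i).aemeasurable (by fun_prop)]
    simp [this]
  have hvar : Var[S; P] = n * V := by
    have h := variance_sum_pi (μ := fun _ : Fin n => gaussianReal 0 1) (X := fun _ x => x ^ 2)
      (fun i => memLp_sq_gaussian)
    have e : S = ∑ i, fun x : Fin n → ℝ => x i ^ 2 := by ext x; simp [S]
    rw [e, h]; simp [V]
  have hS' : MemLp (fun x => S x / n - 1) 2 P := by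
    simp only [div_eq_mul_inv]
    exact (hS.mul_const (n : ℝ)⁻¹).sub (memLp_const (1 : ℝ))
  have hsec : ∫ x, (S x / n - 1) ^ 2 ∂P = V / n := by
    rw [variance_eq_integral hS.aemeasurable, hmean] at hvar
    have : ∀ x, (S x / n - 1) ^ 2 = (S x - n) ^ 2 / n ^ 2 := fun x => by field_simp
    simp_rw [this]
    rw [integral_div, hvar]
    field_simp
  have habs := integral_abs_sq_le P _ hS'
  rw [hsec] at habs
  have habs' : ∫ x, |S x / n - 1| ∂P ≤ √(V / n) := Real.le_sqrt_of_sq_le habs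
  have hpt : ∀ x : Fin n → ℝ, |‖WithLp.toLp 2 x‖ / √n - 1| ≤ |S x / n - 1| := by
    intro x
    have e : S x / n = (‖WithLp.toLp 2 x‖ / √n) ^ 2 := by
      rw [div_pow, Real.sq_sqrt hn'.le, EuclideanSpace.real_norm_sq_eq]
    rw [e]
    set r := ‖WithLp.toLp 2 x‖ / √n
    have hr : 0 ≤ r := by positivity
    rw [show r ^ 2 - 1 = (r - 1) * (r + 1) by ring, abs_mul]
    refine le_mul_of_one_le_right (abs_nonneg _) ?_
    rw [abs_of_nonneg (by linarith)]; linarith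
  have hint : Integrable (fun x : Fin n → ℝ => |S x / n - 1|) P := (hS'.integrable (by simp)).abs
  have hint' : Integrable (fun x : Fin n → ℝ => |‖WithLp.toLp 2 x‖ / √n - 1|) P :=
    hint.mono' (by fun_prop) (ae_of_all _ fun x => by simpa using hpt x)
  rw [← map_pi_eq_stdGaussian]
  constructor
  · rw [integrable_map_measure (by fun_prop) (by fun_prop)]
    exact hint'
  · rw [integral_map (by fun_prop) (by fun_prop)]
    exact (integral_mono hint' hint hpt).trans habs'

section
variable {n : ℕ} (μ : Measure (EuclideanSpace ℝ (Fin n))) [IsProbabilityMeasure μ]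

lemma exists_isometry (a b : EuclideanSpace ℝ (Fin n)) (h : ‖a‖ = ‖b‖) :
    ∃ g : EuclideanSpace ℝ (Fin n) ≃ₗᵢ[ℝ] EuclideanSpace ℝ (Fin n), g a = b :=
  ⟨_, Submodule.reflection_sub h⟩

lemma charFun_eq_of_norm_eq
    (hinv : ∀ g : EuclideanSpace ℝ (Fin n) ≃ₗᵢ[ℝ] EuclideanSpace ℝ (Fin n), μ.map g = μ)
    (a b : EuclideanSpace ℝ (Fin n)) (h : ‖a‖ = ‖b‖) : charFun μ a = charFun μ b := by
  obtain ⟨g, rfl⟩ := exists_isometry a b h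
  conv_rhs => rw [← hinv g]
  rw [charFun_apply, charFun_apply, integral_map (by fun_prop) (by fun_prop)]
  simp

lemma secondMoment_eq
    (hinv : ∀ g : EuclideanSpace ℝ (Fin n) ≃ₗᵢ[ℝ] EuclideanSpace ℝ (Fin n), μ.map g = μ)
    (a b : EuclideanSpace ℝ (Fin n)) (h : ‖a‖ = ‖b‖) :
    ∫ x, (inner ℝ x a) ^ 2 ∂μ = ∫ x, (inner ℝ x b) ^ 2 ∂μ := by
  obtain ⟨g, rfl⟩ := exists_isometry a b h
  conv_rhs => rw [← hinv g]
  rw [integral_map (by fun_prop) (by fun_prop)]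
  simp

lemma memLp_inner (R : ℝ) (hR : ∀ᵐ x ∂μ, ‖x‖ = R) (a : EuclideanSpace ℝ (Fin n)) :
    MemLp (fun x => inner ℝ x a) 2 μ := by
  refine MemLp.of_bound (by fun_prop) (R * ‖a‖) ?_
  filter_upwards [hR] with x hx
  rw [← hx]; exact norm_inner_le_norm x a

lemma secondMoment (R : ℝ) (hR : ∀ᵐ x ∂μ, ‖x‖ = R)
    (hinv : ∀ g : EuclideanSpace ℝ (Fin n) ≃ₗᵢ[ℝ] EuclideanSpace ℝ (Fin n), μ.map g = μ)
    (a : EuclideanSpace ℝ (Fin n)) :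
    n * ∫ x, (inner ℝ x a) ^ 2 ∂μ = R ^ 2 * ‖a‖ ^ 2 := by
  have h1 : ∀ i : Fin n, ∫ x, (inner ℝ x a) ^ 2 ∂μ =
      ∫ x, (inner ℝ x (EuclideanSpace.single i ‖a‖)) ^ 2 ∂μ := fun i =>
    secondMoment_eq μ hinv _ _ (by simp)
  have h2 : n * ∫ x, (inner ℝ x a) ^ 2 ∂μ =
      ∑ i : Fin n, ∫ x, (inner ℝ x (EuclideanSpace.single i ‖a‖)) ^ 2 ∂μ := by
    rw [← Finset.sum_congr rfl fun i _ => h1 i]; simp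
  rw [h2, ← integral_finsetSum _ fun i _ => (memLp_inner μ R hR _).integrable_sq]
  have : (fun x : EuclideanSpace ℝ (Fin n) =>
      ∑ i : Fin n, (inner ℝ x (EuclideanSpace.single i ‖a‖)) ^ 2) =ᵐ[μ]
      fun _ => R ^ 2 * ‖a‖ ^ 2 := by
    filter_upwards [hR] with x hx
    rw [← hx, EuclideanSpace.real_norm_sq_eq x, Finset.sum_mul]
    refine Finset.sum_congr rfl fun i _ => ?_
    rw [EuclideanSpace.inner_single_right]
    simp [mul_pow, mul_comm]
  rw [integral_congr_ae this]; simp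

lemma charFun_lipschitz (C : ℝ) (hC : 0 ≤ C) (a : EuclideanSpace ℝ (Fin n))
    (ha : MemLp (fun x => inner ℝ x a) 2 μ) (hq : ∫ x, (inner ℝ x a) ^ 2 ∂μ ≤ C ^ 2) (s : ℝ) :
    ‖charFun μ (s • a) - charFun μ a‖ ≤ C * |s - 1| := by
  have hi : ∀ b : EuclideanSpace ℝ (Fin n),
      Integrable (fun x => Complex.exp ((inner ℝ x b : ℝ) * Complex.I)) μ := fun b =>
    Integrable.of_bound (by fun_prop) 1 (ae_of_all _ fun x => by
      rw [Complex.norm_exp_ofReal_mul_I])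
  rw [charFun_apply, charFun_apply, ← integral_sub (hi _) (hi _)]
  have hpt : ∀ x : EuclideanSpace ℝ (Fin n),
      ‖Complex.exp ((inner ℝ x (s • a) : ℝ) * Complex.I)
        - Complex.exp ((inner ℝ x a : ℝ) * Complex.I)‖ ≤ |inner ℝ x a| * |s - 1| := by
    intro x
    have e : Complex.exp ((inner ℝ x (s • a) : ℝ) * Complex.I)
        - Complex.exp ((inner ℝ x a : ℝ) * Complex.I) =
        Complex.exp ((inner ℝ x a : ℝ) * Complex.I) *
          (Complex.exp (Complex.I * ((inner ℝ x a * (s - 1) : ℝ))) - 1) := by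
      rw [mul_sub, ← Complex.exp_add, inner_smul_right]
      push_cast; ring_nf
    rw [e, norm_mul, Complex.norm_exp_ofReal_mul_I, one_mul, ← abs_mul]
    exact Real.norm_exp_I_mul_ofReal_sub_one_le
  have hI : Integrable (fun x => |inner ℝ x a|) μ := (ha.integrable (by simp)).abs
  have h1 : ∫ x, |inner ℝ x a| ∂μ ≤ C := by
    refine le_of_sq_le_sq ((integral_abs_sq_le μ _ ha).trans hq) hC
  calc _ ≤ ∫ x, |inner ℝ x a| * |s - 1| ∂μ :=
        norm_integral_le_of_norm_le (hI.mul_const _) (ae_of_all _ hpt)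
    _ = (∫ x, |inner ℝ x a| ∂μ) * |s - 1| := integral_mul_const _ _
    _ ≤ _ := by gcongr

lemma integral_charFun (R : ℝ) (hR : ∀ᵐ x ∂μ, ‖x‖ = R) (s : ℝ) :
    ∫ z, charFun μ (s • z) ∂(stdGaussian (EuclideanSpace ℝ (Fin n))) =
      Complex.exp (-((s * R) ^ 2 / 2 : ℝ)) := by
  simp_rw [charFun_apply]
  rw [integral_integral_swap]
  · have : (fun x : EuclideanSpace ℝ (Fin n) => ∫ z, Complex.exp ((inner ℝ x (s • z) : ℝ) * Complex.I)
        ∂(stdGaussian (EuclideanSpace ℝ (Fin n)))) =ᵐ[μ]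
        fun _ => Complex.exp (-((s * R) ^ 2 / 2 : ℝ)) := by
      filter_upwards [hR] with x hx
      have h := charFun_stdGaussian (s • x)
      rw [charFun_apply] at h
      have e : ∀ z : EuclideanSpace ℝ (Fin n), (inner ℝ x (s • z) : ℝ) = inner ℝ z (s • x) := by
        intro z; rw [inner_smul_right, inner_smul_right, real_inner_comm]
      simp_rw [e]
      rw [h, ← Complex.ofReal_pow, norm_smul, hx, mul_pow, Real.norm_eq_abs, sq_abs]
      push_cast
      ring_nf
    rw [integral_congr_ae this]; simp
  · refine Integrable.of_bound (by fun_prop) 1 (ae_of_all _ fun x => ?_)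
    simp only [Function.uncurry]
    rw [Complex.norm_exp_ofReal_mul_I]

lemma charFun_close (hn : 0 < n) (c : ℝ) (hc : 0 < c) (hR : ∀ᵐ x ∂μ, ‖x‖ = c * √n)
    (hinv : ∀ g : EuclideanSpace ℝ (Fin n) ≃ₗᵢ[ℝ] EuclideanSpace ℝ (Fin n), μ.map g = μ)
    (a : EuclideanSpace ℝ (Fin n)) :
    ‖charFun μ a - Complex.exp (-((‖a‖ * c) ^ 2 / 2 : ℝ))‖ ≤
      c * ‖a‖ * √(Var[fun x : ℝ => x ^ 2; gaussianReal 0 1] / n) := by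
  have hn' : (0 : ℝ) < n := by exact_mod_cast hn
  obtain ⟨hg1, hg2⟩ := gaussian_norm n hn
  have hq : ∫ x, (inner ℝ x a) ^ 2 ∂μ ≤ (c * ‖a‖) ^ 2 := by
    have h := secondMoment μ _ hR hinv a
    rw [mul_pow, Real.sq_sqrt hn'.le] at h
    refine le_of_eq (mul_left_cancel₀ hn'.ne' (h.trans (by ring)))
  have hlip := charFun_lipschitz μ (c * ‖a‖) (by positivity) a (memLp_inner μ _ hR a) hq
  have hI := integral_charFun μ _ hR (‖a‖ / √n)
  rw [show ‖a‖ / √n * (c * √n) = ‖a‖ * c by field_simp] at hI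
  have e : ∀ z : EuclideanSpace ℝ (Fin n),
      charFun μ ((‖a‖ / √n) • z) = charFun μ ((‖z‖ / √n) • a) := fun z =>
    charFun_eq_of_norm_eq μ hinv _ _ (by
      rw [norm_smul, norm_smul, norm_div, norm_div, norm_norm, norm_norm]; ring)
  simp_rw [e] at hI
  have hint : Integrable (fun z => charFun μ ((‖z‖ / √n) • a))
      (stdGaussian (EuclideanSpace ℝ (Fin n))) :=
    Integrable.of_bound (by fun_prop) 1 (ae_of_all _ fun x => norm_charFun_le_one _)
  rw [← hI, norm_sub_rev]
  calc _ = ‖∫ z, (charFun μ ((‖z‖ / √n) • a) - charFun μ a)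
          ∂(stdGaussian (EuclideanSpace ℝ (Fin n)))‖ := by
        rw [integral_sub hint (integrable_const _)]; simp
    _ ≤ ∫ z, c * ‖a‖ * |‖z‖ / √n - 1| ∂(stdGaussian (EuclideanSpace ℝ (Fin n))) :=
        norm_integral_le_of_norm_le (hg1.const_mul _) (ae_of_all _ fun z => hlip _)
    _ = c * ‖a‖ * ∫ z, |‖z‖ / √n - 1| ∂(stdGaussian (EuclideanSpace ℝ (Fin n))) :=
        integral_const_mul _ _
    _ ≤ _ := by gcongr
end

/-- The first `k` coordinates. -/
noncomputable def proj (k n : ℕ) (x : EuclideanSpace ℝ (Fin n)) : EuclideanSpace ℝ (Fin k) :=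
  WithLp.toLp 2 (fun i : Fin k => if h : (i : ℕ) < n then x ⟨i, h⟩ else 0)

lemma continuous_proj (k n : ℕ) : Continuous (proj k n) := by
  unfold proj
  refine (PiLp.continuous_toLp 2 _).comp (continuous_pi fun i => ?_)
  split_ifs <;> fun_prop

lemma exists_lift (k n : ℕ) (h : k ≤ n) (t : EuclideanSpace ℝ (Fin k)) :
    ∃ a : EuclideanSpace ℝ (Fin n), ‖a‖ = ‖t‖ ∧ ∀ x, inner ℝ (proj k n x) t = inner ℝ x a := by
  obtain ⟨m, rfl⟩ := Nat.exists_eq_add_of_le h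
  refine ⟨WithLp.toLp 2 (Fin.append (fun i => t i) (fun _ : Fin m => (0 : ℝ))), ?_, fun x => ?_⟩
  · rw [EuclideanSpace.norm_eq, EuclideanSpace.norm_eq, Fin.sum_univ_add]
    simp
  · simp only [PiLp.inner_apply, Fin.sum_univ_add]
    simp only [proj, Fin.append_left, Fin.append_right, inner_zero_right, Finset.sum_const_zero,
      add_zero]
    refine Finset.sum_congr rfl fun i _ => ?_
    rw [dif_pos (by omega)]
    rfl

end MaxwellPoincare

theorem MaxwellPoincare.aux (c : ℝ) (hc : 0 < c) (v : NNReal) (hv : (v : ℝ) = c ^ 2)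
    (μ : ∀ n : ℕ, Measure (EuclideanSpace ℝ (Fin n)))
    (hprob : ∀ n, IsProbabilityMeasure (μ n))
    (hsupp : ∀ n, 1 ≤ n →
      μ n (Metric.sphere (0 : EuclideanSpace ℝ (Fin n)) (c * Real.sqrt n)) = 1)
    (hinv : ∀ n (g : EuclideanSpace ℝ (Fin n) ≃ₗᵢ[ℝ] EuclideanSpace ℝ (Fin n)),
      Measure.map g (μ n) = μ n) :
    ∀ (k : ℕ) (g : BoundedContinuousFunction (Fin k → ℝ) ℝ),
      Tendsto
        (fun n => ∫ x, g (fun i : Fin k => if h : (i : ℕ) < n then x ⟨i, h⟩ else 0) ∂ μ n)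
        atTop
        (nhds (∫ y, g y ∂ (Measure.pi fun _ : Fin k =>
          gaussianReal 0 v))) := by
  intro k g
  have hk : ∀ n, IsProbabilityMeasure ((μ n).map (MaxwellPoincare.proj k n)) := fun n =>
    Measure.isProbabilityMeasure_map (MaxwellPoincare.continuous_proj k n).measurable.aemeasurable
  let G : Measure (Fin k → ℝ) :=
    Measure.pi fun _ : Fin k => gaussianReal 0 v
  have hG0 : IsProbabilityMeasure G := by dsimp only [G]; infer_instance
  have hG : IsProbabilityMeasure (G.map (WithLp.toLp 2)) :=
    Measure.isProbabilityMeasure_map (by fun_prop)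
  let P : ℕ → ProbabilityMeasure (EuclideanSpace ℝ (Fin k)) := fun n => ⟨_, hk n⟩
  let P₀ : ProbabilityMeasure (EuclideanSpace ℝ (Fin k)) := ⟨_, hG⟩
  have key : Tendsto P atTop (nhds P₀) := by
    refine ProbabilityMeasure.tendsto_of_tendsto_charFun fun t => ?_
    have h0 : charFun (G.map (WithLp.toLp 2)) t = Complex.exp (-((‖t‖ * c) ^ 2 / 2 : ℝ)) := by
      rw [charFun_pi]
      simp_rw [charFun_gaussianReal]
      rw [← Complex.exp_sum, mul_pow, EuclideanSpace.real_norm_sq_eq, Finset.sum_mul,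
        Finset.sum_div]
      push_cast
      rw [← Finset.sum_neg_distrib]
      congr 1
      refine Finset.sum_congr rfl fun i _ => ?_
      rw [hv]
      push_cast
      ring
    change Tendsto (fun n => charFun ((μ n).map (MaxwellPoincare.proj k n)) t) atTop
      (nhds (charFun (G.map (WithLp.toLp 2)) t))
    rw [h0, tendsto_iff_norm_sub_tendsto_zero]
    have hlim : Tendsto (fun n : ℕ => c * ‖t‖ *
        √(Var[fun x : ℝ => x ^ 2; gaussianReal 0 1] / n)) atTop (nhds 0) := by
      have h1 := tendsto_const_div_atTop_nhds_zero_nat (Var[fun x : ℝ => x ^ 2; gaussianReal 0 1])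
      have h2 := (Real.continuous_sqrt.tendsto 0).comp h1
      simpa using h2.const_mul (c * ‖t‖)
    refine squeeze_zero' (Eventually.of_forall fun n => norm_nonneg _) ?_ hlim
    filter_upwards [eventually_ge_atTop k, eventually_ge_atTop 1] with n hkn hn
    obtain ⟨a, ha, hin⟩ := MaxwellPoincare.exists_lift k n hkn t
    have hp := hprob n
    have e : charFun ((μ n).map (MaxwellPoincare.proj k n)) t = charFun (μ n) a := by
      rw [charFun_apply, charFun_apply,
        integral_map (MaxwellPoincare.continuous_proj k n).measurable.aemeasurable (by fun_prop)]
      simp_rw [hin]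
    have hR : ∀ᵐ x ∂(μ n), ‖x‖ = c * √n := by
      have h := (prob_compl_eq_zero_iff (μ := μ n) Metric.isClosed_sphere.measurableSet).2
        (hsupp n hn)
      filter_upwards [measure_eq_zero_iff_ae_notMem.1 h] with x hx
      simpa using hx
    rw [e, ← ha]
    exact MaxwellPoincare.charFun_close (μ n) hn c hc hR (hinv n) a
  rw [ProbabilityMeasure.tendsto_iff_forall_integral_tendsto] at key
  have h := key (g.compContinuous ⟨WithLp.ofLp, PiLp.continuous_ofLp 2 _⟩)
  have hgm : ∀ ν : Measure (EuclideanSpace ℝ (Fin k)),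
      AEStronglyMeasurable (fun x => g (WithLp.ofLp x)) ν := fun ν =>
    (g.continuous.comp (PiLp.continuous_ofLp 2 _)).aestronglyMeasurable
  have e1 : ∀ n, ∫ x, g (WithLp.ofLp x) ∂((μ n).map (MaxwellPoincare.proj k n)) =
      ∫ x, g (fun i : Fin k => if h : (i : ℕ) < n then x ⟨i, h⟩ else 0) ∂ μ n := fun n => by
    rw [integral_map (MaxwellPoincare.continuous_proj k n).measurable.aemeasurable
      (hgm _)]
    rfl
  have e2 : ∫ x, g (WithLp.ofLp x) ∂(G.map (WithLp.toLp 2)) = ∫ y, g y ∂G := by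
    exact integral_map (φ := WithLp.toLp 2) (by fun_prop) (hgm _)
  change Tendsto (fun n => ∫ x, g (WithLp.ofLp x) ∂((μ n).map (MaxwellPoincare.proj k n))) atTop
    (nhds (∫ x, g (WithLp.ofLp x) ∂(G.map (WithLp.toLp 2)))) at h
  rw [e2] at h
  simpa only [e1] using h

/-- Maxwell–Poincaré lemma: the uniform (rotation-invariant) probability measures on the
spheres of radius `c√n` in `ℝⁿ` converge weakly, through every finite set of coordinates,
to the product of Gaussian measures of mean `0` and variance `c²`; i.e. for each fixed `k`,
the joint distribution of the first `k` coordinates converges weakly to the `k`-dimensional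
centered Gaussian with covariance `c² I`. -/
theorem maxwell_poincare_lemma (c : ℝ) (hc : 0 < c)
    (μ : ∀ n : ℕ, Measure (EuclideanSpace ℝ (Fin n)))
    (hprob : ∀ n, IsProbabilityMeasure (μ n))
    (hsupp : ∀ n, 1 ≤ n →
      μ n (Metric.sphere (0 : EuclideanSpace ℝ (Fin n)) (c * Real.sqrt n)) = 1)
    (hinv : ∀ n (g : EuclideanSpace ℝ (Fin n) ≃ₗᵢ[ℝ] EuclideanSpace ℝ (Fin n)),
      Measure.map g (μ n) = μ n) :
    ∀ (k : ℕ) (g : BoundedContinuousFunction (Fin k → ℝ) ℝ),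
      Tendsto
        (fun n => ∫ x, g (fun i : Fin k => if h : (i : ℕ) < n then x ⟨i, h⟩ else 0) ∂ μ n)
        atTop
        (nhds (∫ y, g y ∂ (Measure.pi fun _ : Fin k =>
          gaussianReal 0 (⟨c ^ 2, sq_nonneg c⟩ : NNReal)))) := by
  exact MaxwellPoincare.aux c hc _ rfl μ hprob hsupp hinv
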